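/- arXiv:1111.5796 — 2 statements merged into one kernel-verified Lean document; each statement's English description precedes it below -/
import Mathlib

section
/- The nonlocal function V₂ = -(1/(2c₁²))·Σ_{i=1,2} ((c₁²-4c₀u)u p_i² + 2c₁(c₁u+2c₀)p_i + c₁²u)·exp(2z_i) is a (shadow of a) nonlocal symmetry of the Krichever–Novikov equation: D_t(V₂) - (G₁)_⋆(V₂) = 0, where D_x and D_t are extended to the nonlocal variables p_i, z_i by the covering equations. -/
noncomputable section

open Real

/-- Total `x`-derivative (on solutions: partial derivative in `x`). -/
def Dx (f : ℝ → ℝ → ℝ) : ℝ → ℝ → ℝ := fun x t => deriv (fun y => f y t) x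

/-- Total `t`-derivative (on solutions: partial derivative in `t`). -/
def Dt (f : ℝ → ℝ → ℝ) : ℝ → ℝ → ℝ := fun x t => deriv (fun s => f x s) t

/-- The cubic polynomial `P(u) = u³ + c₁ u + c₀`. -/
def Pcub (c₀ c₁ v : ℝ) : ℝ := v ^ 3 + c₁ * v + c₀

/-- `P′(u) = 3u² + c₁`. -/
def Pder (c₁ v : ℝ) : ℝ := 3 * v ^ 2 + c₁

/-- Right-hand side of the Krichever–Novikov equation. -/
def G1 (c₀ c₁ : ℝ) (u : ℝ → ℝ → ℝ) : ℝ → ℝ → ℝ := fun x t =>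
  Dx (Dx (Dx u)) x t - (3 / 2) * (Dx (Dx u) x t) ^ 2 / Dx u x t
    + Pcub c₀ c₁ (u x t) / Dx u x t

/-- Fréchet derivative of `G₁` applied to `G`:
`(G₁)⋆(G) = Σ_k (∂G₁/∂u_{kx}) Dₓᵏ(G)` with the explicit partial derivatives
`∂G₁/∂u = P′/u_x`, `∂G₁/∂u_x = (3/2)u_xx²/u_x² - P/u_x²`,
`∂G₁/∂u_xx = -3u_xx/u_x`, `∂G₁/∂u_xxx = 1`. -/
def FrG1 (c₀ c₁ : ℝ) (u G : ℝ → ℝ → ℝ) : ℝ → ℝ → ℝ := fun x t =>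
  (Pder c₁ (u x t) / Dx u x t) * G x t
    + ((3 / 2) * (Dx (Dx u) x t) ^ 2 / (Dx u x t) ^ 2
        - Pcub c₀ c₁ (u x t) / (Dx u x t) ^ 2) * Dx G x t
    + (-(3 * Dx (Dx u) x t) / Dx u x t) * Dx (Dx G) x t
    + Dx (Dx (Dx G)) x t

/-- Coefficient `k₁` of the covering. -/
def k1 (c₀ c₁ : ℝ) (u : ℝ → ℝ → ℝ) : ℝ → ℝ → ℝ := fun x t =>
  -(Real.sqrt 6 * (c₁ * u x t + 2 * c₀)) / (12 * Real.sqrt c₀ * Dx u x t)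

/-- Coefficient `k₂` of the covering. -/
def k2 (c₀ c₁ : ℝ) (u : ℝ → ℝ → ℝ) : ℝ → ℝ → ℝ := fun x t =>
  Real.sqrt 6 * c₁ * u x t / (12 * Real.sqrt c₀ * Dx u x t)

/-- Coefficient `k₃` of the covering. -/
def k3 (c₀ c₁ : ℝ) (u : ℝ → ℝ → ℝ) : ℝ → ℝ → ℝ := fun x t =>
  Real.sqrt 6 * u x t * (4 * c₀ * u x t - c₁ ^ 2) / (12 * c₁ * Real.sqrt c₀ * Dx u x t)

/-- Coefficient `m` of the covering. -/
def mco (c₀ c₁ : ℝ) (u : ℝ → ℝ → ℝ) : ℝ → ℝ → ℝ := fun x t =>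
  2 * (c₁ ^ 2 - 8 * c₀ * u x t - 2 * c₁ * (u x t) ^ 2) / (3 * c₁ * Dx u x t)

/-- Coefficient `l₁` of the covering. -/
def l1 (c₀ c₁ : ℝ) (u : ℝ → ℝ → ℝ) : ℝ → ℝ → ℝ := fun x t =>
  -(Real.sqrt 6 / (72 * Real.sqrt c₀ * (Dx u x t) ^ 3)) *
    (-(6 * c₁ * u x t * Dx u x t * Dx (Dx (Dx u)) x t)
      - 12 * c₀ * Dx u x t * Dx (Dx (Dx u)) x t
      + 3 * c₁ * u x t * (Dx (Dx u) x t) ^ 2 + 6 * c₀ * (Dx (Dx u) x t) ^ 2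
      + 12 * c₁ * (Dx u x t) ^ 2 * Dx (Dx u) x t
      + 4 * Real.sqrt 6 * Real.sqrt c₀ * (u x t) ^ 2 * (Dx u x t) ^ 2
      - 2 * c₁ * (u x t) ^ 4 - 4 * c₀ * (u x t) ^ 3 - 2 * c₁ ^ 2 * (u x t) ^ 2
      - 6 * c₀ * c₁ * u x t - 4 * c₀ ^ 2)

/-- Coefficient `l₂` of the covering. -/
def l2 (c₀ c₁ : ℝ) (u : ℝ → ℝ → ℝ) : ℝ → ℝ → ℝ := fun x t =>
  Real.sqrt 6 * c₁ / (72 * Real.sqrt c₀ * (Dx u x t) ^ 3) *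
    (-(6 * u x t * Dx u x t * Dx (Dx (Dx u)) x t)
      + 3 * u x t * (Dx (Dx u) x t) ^ 2 + 12 * (Dx u x t) ^ 2 * Dx (Dx u) x t
      + 4 * Real.sqrt 6 * Real.sqrt c₀ * (Dx u x t) ^ 2
      - 2 * (u x t) ^ 4 - 2 * c₁ * (u x t) ^ 2 - 2 * c₀ * u x t)

/-- Coefficient `l₃` of the covering. -/
def l3 (c₀ c₁ : ℝ) (u : ℝ → ℝ → ℝ) : ℝ → ℝ → ℝ := fun x t =>
  -(Real.sqrt 6 / (72 * c₁ * Real.sqrt c₀ * (Dx u x t) ^ 3)) *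
    (-(6 * c₁ ^ 2 * u x t * Dx u x t * Dx (Dx (Dx u)) x t)
      + 24 * c₀ * (u x t) ^ 2 * Dx u x t * Dx (Dx (Dx u)) x t
      + 3 * c₁ ^ 2 * u x t * (Dx (Dx u) x t) ^ 2
      - 12 * c₀ * (u x t) ^ 2 * (Dx (Dx u) x t) ^ 2
      + 12 * c₁ ^ 2 * (Dx u x t) ^ 2 * Dx (Dx u) x t
      - 96 * c₀ * u x t * (Dx u x t) ^ 2 * Dx (Dx u) x t
      + 96 * c₀ * (Dx u x t) ^ 4
      - 4 * Real.sqrt 6 * Real.sqrt c₀ * c₁ ^ 2 * (Dx u x t) ^ 2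
      + 32 * Real.sqrt 6 * (c₀ * Real.sqrt c₀) * u x t * (Dx u x t) ^ 2
      + 8 * Real.sqrt 6 * Real.sqrt c₀ * c₁ * (u x t) ^ 2 * (Dx u x t) ^ 2
      + 8 * c₀ * (u x t) ^ 5 - 2 * c₁ ^ 2 * (u x t) ^ 4 + 8 * c₀ * c₁ * (u x t) ^ 3
      - 2 * c₁ ^ 3 * (u x t) ^ 2 + 8 * c₀ ^ 2 * (u x t) ^ 2 - 2 * c₀ * c₁ ^ 2 * u x t)

/-- The nonlocal function `V₂`. -/
def V2 (c₀ c₁ : ℝ) (u p1 z1 p2 z2 : ℝ → ℝ → ℝ) : ℝ → ℝ → ℝ := fun x t =>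
  -(1 / (2 * c₁ ^ 2)) *
    (((c₁ ^ 2 - 4 * c₀ * u x t) * u x t * (p1 x t) ^ 2
        + 2 * c₁ * (c₁ * u x t + 2 * c₀) * p1 x t + c₁ ^ 2 * u x t)
        * Real.exp (2 * z1 x t)
      + ((c₁ ^ 2 - 4 * c₀ * u x t) * u x t * (p2 x t) ^ 2
        + 2 * c₁ * (c₁ * u x t + 2 * c₀) * p2 x t + c₁ ^ 2 * u x t)
        * Real.exp (2 * z2 x t))

/-- The quadratic polynomial in `p` that multiplies the exponentials in `V₂`. -/
def quad (c₀ c₁ v p : ℝ) : ℝ :=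
  (c₁ ^ 2 - 4 * c₀ * v) * v * p ^ 2 + 2 * c₁ * (c₁ * v + 2 * c₀) * p + c₁ ^ 2 * v

/-- `∂/∂p` of `quad`. -/
def quadP (c₀ c₁ v p : ℝ) : ℝ :=
  2 * ((c₁ ^ 2 - 4 * c₀ * v) * v) * p + 2 * c₁ * (c₁ * v + 2 * c₀)

/-- `∂/∂v` of `quad`. -/
def quadV (c₀ c₁ v p : ℝ) : ℝ :=
  (c₁ ^ 2 - 8 * c₀ * v) * p ^ 2 + 2 * c₁ ^ 2 * p + c₁ ^ 2

/-- `∂²/∂v∂p` of `quad`. -/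
def quadVP (c₀ c₁ v p : ℝ) : ℝ :=
  2 * (c₁ ^ 2 - 8 * c₀ * v) * p + 2 * c₁ ^ 2

/-- The quadratic polynomial in `p` governing the `t`-part of the covering, as a function of
`v, v₁, v₂, v₃`, the values of `u` and its first three `x`-derivatives. -/
def flow (r c₀ c₁ v v₁ v₂ v₃ p : ℝ) : ℝ :=
  -(3 * (2 * v₁ * v₃ - v₂ ^ 2) + 2 * Pcub c₀ c₁ v) * quad c₀ c₁ v p
    + 12 * v₁ ^ 2 * v₂ * quadV c₀ c₁ v p + 96 * c₀ * v₁ ^ 4 * p ^ 2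
    + 24 * r * v₁ ^ 2 *
      ((8 * c₀ * v + 2 * c₁ * v ^ 2 - c₁ ^ 2) * p ^ 2 + 2 * c₁ * v ^ 2 * p + c₁ ^ 2)

/-- `∂/∂p` of `flow`. -/
def flowP (r c₀ c₁ v v₁ v₂ v₃ p : ℝ) : ℝ :=
  -(3 * (2 * v₁ * v₃ - v₂ ^ 2) + 2 * Pcub c₀ c₁ v) * quadP c₀ c₁ v p
    + 12 * v₁ ^ 2 * v₂ * quadVP c₀ c₁ v p + 192 * c₀ * v₁ ^ 4 * p
    + 24 * r * v₁ ^ 2 *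
      (2 * (8 * c₀ * v + 2 * c₁ * v ^ 2 - c₁ ^ 2) * p + 2 * c₁ * v ^ 2)

/-- One summand of `V₂`, up to the constant factor. -/
def quadExp (c₀ c₁ : ℝ) (u p z : ℝ → ℝ → ℝ) : ℝ → ℝ → ℝ := fun x t =>
  quad c₀ c₁ (u x t) (p x t) * Real.exp (2 * z x t)

lemma Dx_eq {f f' : ℝ → ℝ → ℝ} (h : ∀ x t, HasDerivAt (fun y => f y t) (f' x t) x) :
    Dx f = f' :=
  funext₂ fun x t => (h x t).deriv

lemma hasDerivAt_Dx {f : ℝ → ℝ → ℝ} (hf : ContDiff ℝ (⊤ : ℕ∞) (Function.uncurry f)) (x t : ℝ) :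
    HasDerivAt (fun y => f y t) (Dx f x t) x := by
  have h : ContDiff ℝ (⊤ : ℕ∞) (fun y => f y t) := hf.comp (contDiff_id.prodMk contDiff_const)
  exact (h.differentiable (by simp) x).hasDerivAt

lemma hasDerivAt_Dt {f : ℝ → ℝ → ℝ} (hf : ContDiff ℝ (⊤ : ℕ∞) (Function.uncurry f)) (x t : ℝ) :
    HasDerivAt (fun s => f x s) (Dt f x t) t := by
  have h : ContDiff ℝ (⊤ : ℕ∞) (fun s => f x s) := hf.comp (contDiff_const.prodMk contDiff_id)
  exact (h.differentiable (by simp) t).hasDerivAt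

lemma contDiff_Dx {f : ℝ → ℝ → ℝ} (hf : ContDiff ℝ (⊤ : ℕ∞) (Function.uncurry f)) :
    ContDiff ℝ (⊤ : ℕ∞) (Function.uncurry (Dx f)) := by
  have h : Function.uncurry (Dx f) = fun q => fderiv ℝ (Function.uncurry f) q (1, 0) := by
    ext ⟨x, t⟩
    have hl : HasDerivAt (fun y : ℝ => (y, t)) ((1 : ℝ), (0 : ℝ)) x :=
      (hasDerivAt_id x).prodMk (hasDerivAt_const x t)
    exact ((hf.differentiable (by simp) (x, t)).hasFDerivAt.comp_hasDerivAt x hl).deriv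
  rw [h]
  exact (hf.fderiv_right (by simp)).clm_apply contDiff_const

lemma contDiff_quadExp {c₀ c₁ : ℝ} {u p z : ℝ → ℝ → ℝ}
    (hu : ContDiff ℝ (⊤ : ℕ∞) (Function.uncurry u))
    (hp : ContDiff ℝ (⊤ : ℕ∞) (Function.uncurry p))
    (hz : ContDiff ℝ (⊤ : ℕ∞) (Function.uncurry z)) :
    ContDiff ℝ (⊤ : ℕ∞) (Function.uncurry (quadExp c₀ c₁ u p z)) := by
  have h : Function.uncurry (quadExp c₀ c₁ u p z) = fun q =>
      quad c₀ c₁ (Function.uncurry u q) (Function.uncurry p q)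
        * Real.exp (2 * Function.uncurry z q) := rfl
  rw [h]
  unfold quad
  fun_prop

lemma Dx_const_mul_add {F G : ℝ → ℝ → ℝ} (hF : ContDiff ℝ (⊤ : ℕ∞) (Function.uncurry F))
    (hG : ContDiff ℝ (⊤ : ℕ∞) (Function.uncurry G)) (κ : ℝ) :
    Dx (fun x t => κ * (F x t + G x t)) = fun x t => κ * (Dx F x t + Dx G x t) :=
  Dx_eq fun x t => ((hasDerivAt_Dx hF x t).add (hasDerivAt_Dx hG x t)).const_mul κ

lemma Dt_const_mul_add {F G : ℝ → ℝ → ℝ} (hF : ContDiff ℝ (⊤ : ℕ∞) (Function.uncurry F))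
    (hG : ContDiff ℝ (⊤ : ℕ∞) (Function.uncurry G)) (κ x t : ℝ) :
    Dt (fun x t => κ * (F x t + G x t)) x t = κ * (Dt F x t + Dt G x t) :=
  (((hasDerivAt_Dt hF x t).add (hasDerivAt_Dt hG x t)).const_mul κ).deriv

lemma FrG1_const_mul_add {F G : ℝ → ℝ → ℝ} (hF : ContDiff ℝ (⊤ : ℕ∞) (Function.uncurry F))
    (hG : ContDiff ℝ (⊤ : ℕ∞) (Function.uncurry G)) (c₀ c₁ : ℝ) (u : ℝ → ℝ → ℝ) (κ x t : ℝ) :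
    FrG1 c₀ c₁ u (fun x t => κ * (F x t + G x t)) x t
      = κ * (FrG1 c₀ c₁ u F x t + FrG1 c₀ c₁ u G x t) := by
  unfold FrG1
  rw [Dx_const_mul_add hF hG, Dx_const_mul_add (contDiff_Dx hF) (contDiff_Dx hG),
    Dx_const_mul_add (contDiff_Dx (contDiff_Dx hF)) (contDiff_Dx (contDiff_Dx hG))]
  ring

lemma HasDerivAt.quad {v p : ℝ → ℝ} {v' p' s : ℝ} (c₀ c₁ : ℝ) (hv : HasDerivAt v v' s)
    (hp : HasDerivAt p p' s) :
    HasDerivAt (fun y => quad c₀ c₁ (v y) (p y))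
      (quadV c₀ c₁ (v s) (p s) * v' + quadP c₀ c₁ (v s) (p s) * p') s := by
  unfold _root_.quad
  refine HasDerivAt.congr_deriv ((((((hv.const_mul (4 * c₀)).const_sub (c₁ ^ 2)).mul hv).mul (hp.pow 2)).add
    ((((hv.const_mul c₁).add_const (2 * c₀)).const_mul (2 * c₁)).mul hp)).add
    (hv.const_mul (c₁ ^ 2))) ?_
  simp only [quadV, quadP, Pi.mul_apply, Pi.pow_apply]
  push_cast
  ring

lemma HasDerivAt.quadV {v p : ℝ → ℝ} {v' p' s : ℝ} (c₀ c₁ : ℝ) (hv : HasDerivAt v v' s)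
    (hp : HasDerivAt p p' s) :
    HasDerivAt (fun y => quadV c₀ c₁ (v y) (p y))
      (-8 * c₀ * (p s) ^ 2 * v' + quadVP c₀ c₁ (v s) (p s) * p') s := by
  unfold _root_.quadV
  refine HasDerivAt.congr_deriv (((((hv.const_mul (8 * c₀)).const_sub (c₁ ^ 2)).mul (hp.pow 2)).add
    (hp.const_mul (2 * c₁ ^ 2))).add_const (c₁ ^ 2)) ?_
  simp only [quadVP, Pi.pow_apply]
  push_cast
  ring

lemma HasDerivAt.quadP {v p : ℝ → ℝ} {v' p' s : ℝ} (c₀ c₁ : ℝ) (hv : HasDerivAt v v' s)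
    (hp : HasDerivAt p p' s) :
    HasDerivAt (fun y => quadP c₀ c₁ (v y) (p y))
      (quadVP c₀ c₁ (v s) (p s) * v' + 2 * ((c₁ ^ 2 - 4 * c₀ * v s) * v s) * p') s := by
  unfold _root_.quadP
  refine HasDerivAt.congr_deriv ((((((hv.const_mul (4 * c₀)).const_sub (c₁ ^ 2)).mul hv).const_mul 2).mul hp).add
    (((hv.const_mul c₁).add_const (2 * c₀)).const_mul (2 * c₁))) ?_
  simp only [quadVP, Pi.mul_apply]
  ring

lemma HasDerivAt.quadVP {v p : ℝ → ℝ} {v' p' s : ℝ} (c₀ c₁ : ℝ) (hv : HasDerivAt v v' s)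
    (hp : HasDerivAt p p' s) :
    HasDerivAt (fun y => quadVP c₀ c₁ (v y) (p y))
      (-16 * c₀ * p s * v' + 2 * (c₁ ^ 2 - 8 * c₀ * v s) * p') s := by
  unfold _root_.quadVP
  refine HasDerivAt.congr_deriv (((((hv.const_mul (8 * c₀)).const_sub (c₁ ^ 2)).const_mul 2).mul hp).add_const
    (2 * c₁ ^ 2)) ?_
  ring

/-- Each summand of `V₂` solves the linearized equation. The two summands correspond to the two
square roots `r` of `c₀ / 6`. -/
lemma Dt_quadExp {r c₀ c₁ : ℝ} (hr : r ≠ 0) (hc₀ : c₀ = 6 * r ^ 2) (hc₁ : c₁ ≠ 0)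
    {u p z : ℝ → ℝ → ℝ}
    (hu : ContDiff ℝ (⊤ : ℕ∞) (Function.uncurry u))
    (hp : ContDiff ℝ (⊤ : ℕ∞) (Function.uncurry p))
    (hz : ContDiff ℝ (⊤ : ℕ∞) (Function.uncurry z))
    (hux : ∀ x t, Dx u x t ≠ 0)
    (hKN : ∀ x t, Dt u x t = G1 c₀ c₁ u x t)
    (hpx : ∀ x t, Dx p x t = -quad c₀ c₁ (u x t) (p x t) / (12 * c₁ * r * Dx u x t))
    (hzx : ∀ x t, Dx z x t = quadP c₀ c₁ (u x t) (p x t) / (24 * c₁ * r * Dx u x t))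
    (hpt : ∀ x t, Dt p x t
      = -flow r c₀ c₁ (u x t) (Dx u x t) (Dx (Dx u) x t) (Dx (Dx (Dx u)) x t) (p x t)
        / (72 * c₁ * r * Dx u x t ^ 3))
    (hzt : ∀ x t, Dt z x t
      = flowP r c₀ c₁ (u x t) (Dx u x t) (Dx (Dx u) x t) (Dx (Dx (Dx u)) x t) (p x t)
        / (144 * c₁ * r * Dx u x t ^ 3)) (x t : ℝ) :
    Dt (quadExp c₀ c₁ u p z) x t = FrG1 c₀ c₁ u (quadExp c₀ c₁ u p z) x t := by
  have hu₀ := hasDerivAt_Dx hu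
  have hu₁ := hasDerivAt_Dx (contDiff_Dx hu)
  have hu₂ := hasDerivAt_Dx (contDiff_Dx (contDiff_Dx hu))
  have hp₀ := hasDerivAt_Dx hp
  have hE (x t : ℝ) := ((hasDerivAt_Dx hz x t).const_mul 2).exp
  have h₁ : Dx (quadExp c₀ c₁ u p z) = fun x t =>
      Dx u x t * quadV c₀ c₁ (u x t) (p x t) * Real.exp (2 * z x t) := by
    refine Dx_eq fun x t => ?_
    refine HasDerivAt.congr_deriv (((hu₀ x t).quad c₀ c₁ (hp₀ x t)).mul (hE x t)) ?_
    rw [hpx, hzx]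
    have := hux x t
    field_simp
    ring
  have h₂ : Dx (Dx (quadExp c₀ c₁ u p z)) = fun x t =>
      (Dx (Dx u) x t * quadV c₀ c₁ (u x t) (p x t) - 8 * c₀ * (p x t) ^ 2 * Dx u x t ^ 2
        + (quadV c₀ c₁ (u x t) (p x t) * quadP c₀ c₁ (u x t) (p x t)
          - quad c₀ c₁ (u x t) (p x t) * quadVP c₀ c₁ (u x t) (p x t)) / (12 * c₁ * r))
        * Real.exp (2 * z x t) := by
    rw [h₁]
    refine Dx_eq fun x t => ?_
    refine HasDerivAt.congr_deriv (((hu₁ x t).mul ((hu₀ x t).quadV c₀ c₁ (hp₀ x t))).mul (hE x t)) ?_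
    simp only [Pi.mul_apply]
    rw [hpx, hzx]
    have := hux x t
    field_simp
    ring
  have h₃ := (((((hu₂ x t).mul ((hu₀ x t).quadV c₀ c₁ (hp₀ x t))).sub
    ((((hp₀ x t).pow 2).const_mul (8 * c₀)).mul ((hu₁ x t).pow 2))).add
    (((((hu₀ x t).quadV c₀ c₁ (hp₀ x t)).mul ((hu₀ x t).quadP c₀ c₁ (hp₀ x t))).sub
      (((hu₀ x t).quad c₀ c₁ (hp₀ x t)).mul ((hu₀ x t).quadVP c₀ c₁ (hp₀ x t)))).div_const
        (12 * c₁ * r))).mul (hE x t)).deriv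
  have ht : Dt (quadExp c₀ c₁ u p z) x t = _ :=
    (((hasDerivAt_Dt hu x t).quad c₀ c₁ (hasDerivAt_Dt hp x t)).mul
      ((hasDerivAt_Dt hz x t).const_mul 2).exp).deriv
  replace h₃ : Dx (Dx (Dx (quadExp c₀ c₁ u p z))) x t = _ :=
    (congrFun₂ (congrArg Dx h₂) x t).trans h₃
  rw [ht, FrG1, h₃, h₂, h₁, hKN, G1, hpx, hzx, hpt, hzt]
  simp only [quadExp, Pi.mul_apply, Pi.pow_apply, Pi.sub_apply, Pi.add_apply]
  have h0 := hux x t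
  generalize Real.exp (2 * z x t) = E
  generalize Dx (Dx (Dx u)) x t = w₃
  generalize Dx (Dx u) x t = w₂
  generalize Dx u x t = w₁ at *
  generalize u x t = w
  generalize p x t = q
  simp only [flow, flowP, quad, quadV, quadP, quadVP, Pcub, Pder]
  subst hc₀
  field_simp
  ring

/-- `V₂` is a (shadow of a) nonlocal symmetry of the
Krichever–Novikov equation: `D_t(V₂) - (G₁)⋆(V₂) = 0`, with the total
derivatives extended to the nonlocal variables `p₁, z₁, p₂, z₂` by the
covering equations. -/
theorem V2_is_nonlocal_symmetry (c₀ c₁ : ℝ) (hc₀ : 0 < c₀) (hc₁ : c₁ ≠ 0)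
    (u p1 z1 p2 z2 : ℝ → ℝ → ℝ)
    (hu : ContDiff ℝ (⊤ : ℕ∞) (Function.uncurry u))
    (hp1s : ContDiff ℝ (⊤ : ℕ∞) (Function.uncurry p1))
    (hz1s : ContDiff ℝ (⊤ : ℕ∞) (Function.uncurry z1))
    (hp2s : ContDiff ℝ (⊤ : ℕ∞) (Function.uncurry p2))
    (hz2s : ContDiff ℝ (⊤ : ℕ∞) (Function.uncurry z2))
    (hux : ∀ x t, Dx u x t ≠ 0)
    (hKN : ∀ x t, Dt u x t = G1 c₀ c₁ u x t)
    (hp1x : ∀ x t, Dx p1 x t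
      = k3 c₀ c₁ u x t * (p1 x t) ^ 2 + 2 * k1 c₀ c₁ u x t * p1 x t - k2 c₀ c₁ u x t)
    (hp1t : ∀ x t, Dt p1 x t
      = l3 c₀ c₁ u x t * (p1 x t) ^ 2 + 2 * l1 c₀ c₁ u x t * p1 x t - l2 c₀ c₁ u x t)
    (hz1x : ∀ x t, Dx z1 x t = -(k1 c₀ c₁ u x t + p1 x t * k3 c₀ c₁ u x t))
    (hz1t : ∀ x t, Dt z1 x t = -(l1 c₀ c₁ u x t + p1 x t * l3 c₀ c₁ u x t))
    (hp2x : ∀ x t, Dx p2 x t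
      = -(k3 c₀ c₁ u x t * (p2 x t) ^ 2) - 2 * k1 c₀ c₁ u x t * p2 x t + k2 c₀ c₁ u x t)
    (hp2t : ∀ x t, Dt p2 x t
      = -((l3 c₀ c₁ u x t - mco c₀ c₁ u x t) * (p2 x t) ^ 2)
        - (4 * (u x t) ^ 2 / (3 * Dx u x t) + 2 * l1 c₀ c₁ u x t) * p2 x t
        - 2 * c₁ / (3 * Dx u x t) + l2 c₀ c₁ u x t)
    (hz2x : ∀ x t, Dx z2 x t = k1 c₀ c₁ u x t + p2 x t * k3 c₀ c₁ u x t)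
    (hz2t : ∀ x t, Dt z2 x t
      = l1 c₀ c₁ u x t + 2 * (u x t) ^ 2 / (3 * Dx u x t)
        + p2 x t * (l3 c₀ c₁ u x t - mco c₀ c₁ u x t))
    : ∀ x t, Dt (V2 c₀ c₁ u p1 z1 p2 z2) x t
        - FrG1 c₀ c₁ u (V2 c₀ c₁ u p1 z1 p2 z2) x t = 0 := by
  obtain ⟨r, hr, hs⟩ : ∃ r : ℝ, 0 < r ∧ √c₀ = √6 * r :=
    ⟨√c₀ / √6, by positivity, by field_simp⟩
  have h6 : √6 ^ 2 = 6 := Real.sq_sqrt (by norm_num)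
  have hs0 : √6 ≠ 0 := by positivity
  have hc : c₀ = 6 * r ^ 2 := by rw [← Real.sq_sqrt hc₀.le, hs, mul_pow, h6]
  have hr0 := hr.ne'
  have hF₁ := contDiff_quadExp (c₀ := c₀) (c₁ := c₁) hu hp1s hz1s
  have hF₂ := contDiff_quadExp (c₀ := c₀) (c₁ := c₁) hu hp2s hz2s
  have hS₁ := Dt_quadExp (p := p1) (z := z1) hr0 hc hc₁ hu hp1s hz1s hux hKN
    (fun x t => by
      have := hux x t
      rw [hp1x]
      simp only [k1, k2, k3, quad, hs]
      field_simp
      ring)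
    (fun x t => by
      have := hux x t
      rw [hz1x]
      simp only [k1, k3, quadP, hs]
      field_simp
      ring)
    (fun x t => by
      have := hux x t
      rw [hp1t]
      simp only [l1, l2, l3, flow, quad, quadV, Pcub, hs]
      field_simp
      simp only [h6]
      ring)
    (fun x t => by
      have := hux x t
      rw [hz1t]
      simp only [l1, l3, flowP, quadP, quadVP, Pcub, hs]
      field_simp
      simp only [h6]
      ring)
  have hS₂ := Dt_quadExp (r := -r) (p := p2) (z := z2) (neg_ne_zero.mpr hr0) (by rw [hc]; ring)
    hc₁ hu hp2s hz2s hux hKN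
    (fun x t => by
      have := hux x t
      rw [hp2x]
      simp only [k1, k2, k3, quad, hs]
      field_simp
      ring)
    (fun x t => by
      have := hux x t
      rw [hz2x]
      simp only [k1, k3, quadP, hs]
      field_simp
      ring)
    (fun x t => by
      have := hux x t
      rw [hp2t]
      simp only [l1, l2, l3, mco, flow, quad, quadV, Pcub, hs]
      field_simp
      simp only [h6]
      ring)
    (fun x t => by
      have := hux x t
      rw [hz2t]
      simp only [l1, l3, mco, flowP, quadP, quadVP, Pcub, hs]
      field_simp
      simp only [h6]
      ring)
  have hV : V2 c₀ c₁ u p1 z1 p2 z2 = fun x t => -(1 / (2 * c₁ ^ 2)) *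
      (quadExp c₀ c₁ u p1 z1 x t + quadExp c₀ c₁ u p2 z2 x t) := rfl
  intro x t
  rw [hV, Dt_const_mul_add hF₁ hF₂, FrG1_const_mul_add hF₁ hF₂, hS₁, hS₂, sub_self]
end
end

section
/- If V is a symmetry and γ a cosymmetry of an evolution equation u_t = F, then D_x(γV) is a total x-derivative whose pairing behaves so that the operator V∘D_x^{-1}∘γ maps symmetries to symmetries provided D_t(γG) - D_x-exact terms vanish; concretely: for any symmetry G, the quantity W defined by W_x = γG and W_t = Σ_{k≥1}Σ_{m=0}^{k-1}(-D_x)^m((∂F/∂u_{kx})γ)·D_x^{k-m-1}(G) satisfies W_{xt} = W_{tx} by virtue of the equation u_t = F. -/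
noncomputable section

/-- The operator `-Dₓ` acting on functions of `(x,t)`; `NDx^[m] = (-Dₓ)ᵐ`. -/
def NDx (f : ℝ → ℝ → ℝ) : ℝ → ℝ → ℝ := fun x t => -(Dx f x t)

/-- A function of `(x,t)` that is jointly smooth. -/
def JointlySmooth (f : ℝ → ℝ → ℝ) : Prop := ContDiff ℝ (⊤ : ℕ∞) (Function.uncurry f)

namespace JointlySmooth

variable {f g : ℝ → ℝ → ℝ}

theorem mul (hf : JointlySmooth f) (hg : JointlySmooth g) :
    JointlySmooth (fun x t => f x t * g x t) :=
  ContDiff.mul hf hg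

theorem differentiableAt_left (hf : JointlySmooth f) (x t : ℝ) :
    DifferentiableAt ℝ (fun y => f y t) x :=
  ((ContDiff.differentiable hf (by simp)) (x, t)).comp x
    (f := fun y : ℝ => (y, t)) (by fun_prop)

theorem differentiableAt_right (hf : JointlySmooth f) (x t : ℝ) :
    DifferentiableAt ℝ (fun s => f x s) t :=
  ((ContDiff.differentiable hf (by simp)) (x, t)).comp t
    (f := fun s : ℝ => (x, s)) (by fun_prop)

theorem hasDerivAt_left (hf : JointlySmooth f) (x t : ℝ) :
    HasDerivAt (fun y => f y t) (Dx f x t) x :=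
  (hf.differentiableAt_left x t).hasDerivAt

theorem hasDerivAt_right (hf : JointlySmooth f) (x t : ℝ) :
    HasDerivAt (fun s => f x s) (Dt f x t) t :=
  (hf.differentiableAt_right x t).hasDerivAt

theorem dx (hf : JointlySmooth f) : JointlySmooth (Dx f) := by
  have h : Function.uncurry (Dx f) =
      fun p : ℝ × ℝ => fderiv ℝ (Function.uncurry f) p (1, 0) := by
    ext ⟨x, t⟩
    have hd := ((ContDiff.differentiable hf (by simp)) (x, t)).hasFDerivAt
    exact (hd.comp_hasDerivAt x ((hasDerivAt_id x).prodMk (hasDerivAt_const x t))).deriv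
  unfold JointlySmooth
  rw [h]
  exact (ContDiff.fderiv_right hf (by simp)).clm_apply contDiff_const

theorem ndx (hf : JointlySmooth f) : JointlySmooth (NDx f) :=
  ContDiff.neg hf.dx

theorem iterate_dx (hf : JointlySmooth f) (k : ℕ) : JointlySmooth (Dx^[k] f) :=
  Function.Iterate.rec JointlySmooth hf (fun _ h => h.dx) k

theorem iterate_ndx (hf : JointlySmooth f) (k : ℕ) : JointlySmooth (NDx^[k] f) :=
  Function.Iterate.rec JointlySmooth hf (fun _ h => h.ndx) k

/-- Lagrange's identity for `Dₓᵏ` and its formal adjoint `(-Dₓ)ᵏ`. -/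
theorem hasDerivAt_lagrange (hf : JointlySmooth f) (hg : JointlySmooth g) (k : ℕ) (x t : ℝ) :
    HasDerivAt (fun y => ∑ m ∈ Finset.range k, NDx^[m] f y t * Dx^[k - m - 1] g y t)
      (f x t * Dx^[k] g x t - NDx^[k] f x t * g x t) x := by
  have h := HasDerivAt.fun_sum (u := Finset.range k) fun m _ =>
    ((hf.iterate_ndx m).hasDerivAt_left x t).mul
      ((hg.iterate_dx (k - m - 1)).hasDerivAt_left x t)
  refine h.congr_deriv ?_
  have tele := Finset.sum_range_sub' (fun m => NDx^[m] f x t * Dx^[k - m] g x t) k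
  simp only [Function.iterate_zero, id, Nat.sub_zero, Nat.sub_self] at tele
  rw [← tele]
  refine Finset.sum_congr rfl fun m hm => ?_
  have hk : k - m = (k - m - 1) + 1 := by have := Finset.mem_range.mp hm; omega
  have hD : Dx^[k - m] g x t = Dx (Dx^[k - m - 1] g) x t := by
    rw [← Function.iterate_succ_apply' Dx, Nat.succ_eq_add_one, ← hk]
  have hN : NDx^[m + 1] f x t = -Dx (NDx^[m] f) x t := by
    rw [Function.iterate_succ_apply']; rfl
  rw [hD, hN, ← Nat.sub_sub]
  ring

end JointlySmooth

/-- For an evolution equation `u_t = F` of order `n` with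
coefficients `a k = ∂F/∂u_{kx}`, a symmetry `G` (`D_t G = Σ_k a_k Dₓᵏ G`) and a
cosymmetry `γ` (`D_t γ = -Σ_k (-Dₓ)ᵏ(a_k γ)`), the nonlocal variable `W` with
`W_x = γG` and `W_t = Σ_{k≥1} Σ_{m=0}^{k-1} (-Dₓ)ᵐ(a_k γ) · Dₓ^{k-m-1}(G)`
is compatible: `W_{xt} = W_{tx}`, i.e. `D_t(γG) = D_x(W_t-expression)`. -/
theorem W_compatible (n : ℕ) (a : ℕ → ℝ → ℝ → ℝ) (G γ : ℝ → ℝ → ℝ)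
    (has : ∀ k, ContDiff ℝ (⊤ : ℕ∞) (Function.uncurry (a k)))
    (hGs : ContDiff ℝ (⊤ : ℕ∞) (Function.uncurry G))
    (hγs : ContDiff ℝ (⊤ : ℕ∞) (Function.uncurry γ))
    (hG : ∀ x t, Dt G x t = ∑ k ∈ Finset.range (n + 1), a k x t * Dx^[k] G x t)
    (hγ : ∀ x t, Dt γ x t
      = -∑ k ∈ Finset.range (n + 1), NDx^[k] (fun x t => a k x t * γ x t) x t) :
    ∀ x t, Dt (fun x t => γ x t * G x t) x t
      = Dx (fun x t => ∑ k ∈ Finset.range (n + 1), ∑ m ∈ Finset.range k,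
          NDx^[m] (fun x t => a k x t * γ x t) x t * Dx^[k - m - 1] G x t) x t := by
  intro x t
  have hG' : JointlySmooth G := hGs
  have hγ' : JointlySmooth γ := hγs
  have ha : ∀ k, JointlySmooth (a k) := has
  have hL : Dt (fun x t => γ x t * G x t) x t = Dt γ x t * G x t + γ x t * Dt G x t :=
    ((hγ'.hasDerivAt_right x t).mul (hG'.hasDerivAt_right x t)).deriv
  have hR := (HasDerivAt.fun_sum (u := Finset.range (n + 1)) fun k _ =>
    ((ha k).mul hγ').hasDerivAt_lagrange hG' k x t).deriv
  refine hL.trans (Eq.trans ?_ hR.symm)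
  rw [hG, hγ, Finset.sum_sub_distrib, ← Finset.sum_mul, Finset.mul_sum]
  simp only [mul_comm (a _ x t) (γ x t), mul_assoc]
  ring
end
end
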